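/- Let n ≥ 3 be an integer, n − 1 < β < α ≤ ⌈α⌉ = n, a > 0, and let f : ℝ → ℝ, q : [0,∞) → ℝ, g : [0,∞) → ℝ be continuous satisfying (G1) x·f(x) > 0 for all x ≠ 0, (G2) there exist c_1, η > 0 with |f(x)| ≥ c_1|x|^η for all |x| ≥ 1, (H) there exist T_1 > 0 and c_3 > 0 with q(t) ≥ c_3 for all t ≥ T_1, and (K) there exist σ ∈ (n−β,1), c_4 > 0 and T_2 > 0 with g(t) ≥ c_4 t^{n−β−σ} for all t ≥ T_2. Let x be a solution on [0,∞) of (^C D^α_{0^+} x)(t) + a·(^C D^β_{0^+} x)(t) + q(t)·f(x(t)) + sgn(x(t))·g(t) = 0, t > 0, with x(0) = x_0, x^{(i)}(0) = x_i for i = 1,…,n−1, and let y_n be the associated function. If x and y_n are both eventually positive, then limsup_{t→∞} x(t) < ∞. -/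

import Mathlib

open MeasureTheory Filter Set

noncomputable def fracInt (γ : ℝ) (f : ℝ → ℝ) (t : ℝ) : ℝ :=
  (1 / Real.Gamma γ) * ∫ s in (0:ℝ)..t, (t - s) ^ (γ - 1) * f s

noncomputable def taylorPolyAt0 (n : ℕ) (f : ℝ → ℝ) (t : ℝ) : ℝ :=
  ∑ k ∈ Finset.range n, iteratedDeriv k f 0 / (Nat.factorial k : ℝ) * t ^ k

noncomputable def caputoD (γ : ℝ) (f : ℝ → ℝ) : ℝ → ℝ :=
  iteratedDeriv ⌈γ⌉₊
    (fun t => fracInt ((⌈γ⌉₊ : ℝ) - γ) (fun s => f s - taylorPolyAt0 ⌈γ⌉₊ f s) t)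

def ContCaputoDiffOnIci (γ : ℝ) (f : ℝ → ℝ) : Prop :=
  ContDiffOn ℝ (⌈γ⌉₊ - 1 : ℕ) f (Set.Ici 0) ∧ ContinuousOn (caputoD γ f) (Set.Ici 0)

def Oscillatory (x : ℝ → ℝ) : Prop :=
  ∃ u : ℕ → ℝ, (∀ n, 0 ≤ u n) ∧ Filter.Tendsto u Filter.atTop Filter.atTop ∧ ∀ n, x (u n) = 0

noncomputable def assocY (n : ℕ) (α β a : ℝ) (ξ : ℕ → ℝ) (x : ℝ → ℝ) : ℕ → ℝ → ℝ
  | 1 => fun t => fracInt ((n : ℝ) - α) x t + a * fracInt ((n : ℝ) - β) x t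
  | 2 => fun t => caputoD (α - n + 1) x t + a * caputoD (β - n + 1) x t
      + ξ 0 * t ^ ((n : ℝ) - α - 1) / Real.Gamma ((n : ℝ) - α)
      + a * ξ 0 * t ^ ((n : ℝ) - β - 1) / Real.Gamma ((n : ℝ) - β)
  | i => fun t => caputoD (α - n - 1 + i) x t + a * caputoD (β - n - 1 + i) x t
      + (∑ k ∈ Finset.range (i - 1), ξ k *
          (∏ j ∈ Finset.range (i - 1 - k), ((n : ℝ) - α - i + 2 + k + j)) *
          t ^ ((n : ℝ) - α - i + 1 + k) / Real.Gamma ((n : ℝ) - α + 1))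
      + (∑ k ∈ Finset.range (i - 1), a * ξ k *
          (∏ j ∈ Finset.range (i - 1 - k), ((n : ℝ) - β - i + 2 + k + j)) *
          t ^ ((n : ℝ) - β - i + 1 + k) / Real.Gamma ((n : ℝ) - β + 1))

def AbsContOnInterval (f : ℝ → ℝ) (A B : ℝ) : Prop :=
  ∀ ε > (0:ℝ), ∃ δ > (0:ℝ), ∀ m : ℕ, ∀ s t : ℕ → ℝ,
    (∀ i < m, A ≤ s i ∧ s i ≤ t i ∧ t i ≤ B) →
    (∀ i < m, ∀ j < m, i ≠ j → Disjoint (Set.Ioo (s i) (t i)) (Set.Ioo (s j) (t j))) →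
    (∑ i ∈ Finset.range m, (t i - s i)) < δ →
    (∑ i ∈ Finset.range m, |f (t i) - f (s i)|) < ε

/-- The Abel integral `∫₀ᵗ (t - s)^(γ-1) F(s) ds`, that is `Γ(γ)` times the fractional integral. -/
noncomputable def abelInt (γ : ℝ) (F : ℝ → ℝ) (t : ℝ) : ℝ :=
  ∫ s in (0:ℝ)..t, (t - s) ^ (γ - 1) * F s

/-- The kernel arising when a difference quotient of an Abel integral is averaged against
`s ^ (-1 - γ)`. -/
noncomputable def abelKernel (γ z : ℝ) : ℝ := z⁻¹ * (z ^ γ - (max (z - 1) 0) ^ γ)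

lemma abelKernel_nonneg {γ z : ℝ} (hγ : 0 < γ) (hz : 0 < z) : 0 ≤ abelKernel γ z := by
  unfold abelKernel
  have : (max (z - 1) 0) ^ γ ≤ z ^ γ :=
    Real.rpow_le_rpow (le_max_right _ _) (max_le (by linarith) hz.le) hγ.le
  exact mul_nonneg (inv_nonneg.2 hz.le) (by linarith)

lemma abelKernel_eq_of_le_one {γ z : ℝ} (hγ : 0 < γ) (hz : 0 < z) (hz1 : z ≤ 1) :
    abelKernel γ z = z ^ (γ - 1) := by
  unfold abelKernel
  rw [max_eq_right (by linarith), Real.zero_rpow hγ.ne', sub_zero, Real.rpow_sub_one hz.ne']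
  ring

lemma abelKernel_le_of_one_le {γ z : ℝ} (hγ1 : γ ≤ 1) (hz1 : 1 ≤ z) :
    abelKernel γ z ≤ z ^ (γ - 2) := by
  have hz : 0 < z := by linarith
  unfold abelKernel
  rw [max_eq_left (by linarith)]
  have h0 : 0 ≤ (z - 1) / z := div_nonneg (by linarith) hz.le
  have h1 : (z - 1) / z ≤ 1 := by rw [div_le_one hz]; linarith
  have h2 : (z - 1) / z ≤ ((z - 1) / z) ^ γ := Real.self_le_rpow_of_le_one h0 h1 hγ1
  rw [Real.div_rpow (by linarith) hz.le, div_le_div_iff₀ hz (Real.rpow_pos_of_pos hz _)] at h2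
  have h3 : z ^ (γ - 2) = z ^ γ / z ^ 2 := by
    rw [Real.rpow_sub hz]; norm_num
  rw [h3, inv_mul_eq_div, div_le_div_iff₀ hz (by positivity)]
  have h4 : 0 ≤ z := hz.le
  nlinarith

lemma measurable_abelKernel (γ : ℝ) : Measurable (abelKernel γ) := by
  unfold abelKernel
  fun_prop

lemma integrableOn_abelKernel {γ : ℝ} (hγ : 0 < γ) (hγ1 : γ < 1) :
    IntegrableOn (abelKernel γ) (Ioi 0) := by
  rw [← Ioc_union_Ioi_eq_Ioi (zero_le_one' ℝ)]
  refine IntegrableOn.union ?_ ?_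
  · have h : IntegrableOn (fun z : ℝ => z ^ (γ - 1)) (Ioc 0 1) :=
      (intervalIntegrable_iff_integrableOn_Ioc_of_le zero_le_one).1
        (intervalIntegral.intervalIntegrable_rpow' (by linarith))
    exact h.congr_fun (fun z hz => (abelKernel_eq_of_le_one hγ hz.1 hz.2).symm) measurableSet_Ioc
  · refine Integrable.mono' (integrableOn_Ioi_rpow_of_lt (a := γ - 2) (by linarith) one_pos)
      (measurable_abelKernel γ).aestronglyMeasurable ?_
    filter_upwards [ae_restrict_mem measurableSet_Ioi] with z hz
    have hz' : (1:ℝ) < z := hz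
    rw [Real.norm_of_nonneg (abelKernel_nonneg hγ (by linarith))]
    exact abelKernel_le_of_one_le hγ1.le hz'.le

lemma hasDerivAt_div_sub_one_rpow {γ τ s : ℝ} (hγ : γ ≠ 0) (hs : 0 < s) (hsτ : s < τ) :
    HasDerivAt (fun s => -(γ⁻¹ * τ⁻¹ * (τ / s - 1) ^ γ)) (s ^ (-1 - γ) * (τ - s) ^ (γ - 1)) s := by
  have hτ : 0 < τ := hs.trans hsτ
  have h0 : 0 < τ / s - 1 := by rw [sub_pos, one_lt_div hs]; exact hsτ
  have h1 : HasDerivAt (fun s => τ / s - 1) (τ * -(s ^ 2)⁻¹) s := by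
    simpa [div_eq_mul_inv] using ((hasDerivAt_inv hs.ne').const_mul τ).sub_const 1
  have h2 := ((h1.rpow_const (p := γ) (Or.inl h0.ne')).const_mul (γ⁻¹ * τ⁻¹)).neg
  refine h2.congr_deriv ?_
  have h3 : τ / s - 1 = (τ - s) / s := by field_simp
  have h4 : s ^ (-1 - γ) = (s ^ 2)⁻¹ * (s ^ (γ - 1))⁻¹ := by
    rw [← Real.rpow_neg hs.le, ← Real.rpow_natCast, ← Real.rpow_neg hs.le, ← Real.rpow_add hs]
    congr 1; push_cast; ring
  rw [h3, Real.div_rpow (by linarith) hs.le, h4]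
  field_simp

lemma integral_indicator_rpow_mul {γ t ε r τ : ℝ} (hγ : 0 < γ) (hγ1 : γ < 1) (hε : 0 < ε)
    (hεr : ε < r) (hτt : τ < t) (hτ : 0 < τ) :
    ∫ s, (Ioc ε r).indicator (fun s => s ^ (-1 - γ)) s *
        (Ioo 0 t).indicator (fun z => z ^ (γ - 1)) (τ - s) =
      γ⁻¹ * τ⁻¹ * ((max (τ / ε - 1) 0) ^ γ - (max (τ / r - 1) 0) ^ γ) := by
  have hr : 0 < r := hε.trans hεr
  rcases le_or_gt τ ε with h | h
  · have h1 : τ / ε - 1 ≤ 0 := by rw [sub_nonpos, div_le_one hε]; exact h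
    have h2 : τ / r - 1 ≤ 0 := by rw [sub_nonpos, div_le_one hr]; linarith
    rw [max_eq_right h1, max_eq_right h2, sub_self, mul_zero]
    rw [← integral_zero ℝ ℝ (μ := volume)]
    congr 1
    ext s
    by_cases hs : s ∈ Ioc ε r
    · have : τ - s ∉ Ioo 0 t := fun h' => by have := h'.1; have := hs.1; linarith
      simp [this]
    · simp [hs]
  · have hm : ε ≤ min r τ := le_min hεr.le h.le
    have h1 : (fun s => (Ioc ε r).indicator (fun s => s ^ (-1 - γ)) s *
        (Ioo 0 t).indicator (fun z => z ^ (γ - 1)) (τ - s)) =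
        (Ioc ε (min r τ)).indicator (fun s => s ^ (-1 - γ) * (τ - s) ^ (γ - 1)) := by
      ext s
      by_cases hs : s ∈ Ioc ε r
      · rcases lt_trichotomy s τ with h' | h' | h'
        · have a1 : τ - s ∈ Ioo 0 t := ⟨by linarith, by linarith [hs.1]⟩
          have a2 : s ∈ Ioc ε (min r τ) := ⟨hs.1, le_min hs.2 h'.le⟩
          simp only [indicator_of_mem hs, indicator_of_mem a1, indicator_of_mem a2]
        · have a2 : s ∈ Ioc ε (min r τ) := ⟨hs.1, le_min hs.2 h'.le⟩
          rw [indicator_of_mem a2, h', sub_self, Real.zero_rpow (by linarith)]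
          simp
        · have a1 : τ - s ∉ Ioo 0 t := fun hh => by linarith [hh.1]
          have a2 : s ∉ Ioc ε (min r τ) := fun hh => by
            linarith [hh.2.trans (min_le_right _ _)]
          rw [indicator_of_notMem a1, indicator_of_notMem a2, mul_zero]
      · have a2 : s ∉ Ioc ε (min r τ) := fun hh => hs ⟨hh.1, hh.2.trans (min_le_left _ _)⟩
        rw [indicator_of_notMem hs, indicator_of_notMem a2, zero_mul]
    rw [h1, integral_indicator measurableSet_Ioc, ← intervalIntegral.integral_of_le hm]
    have hcont : ContinuousOn (fun s => -(γ⁻¹ * τ⁻¹ * (τ / s - 1) ^ γ)) (Icc ε (min r τ)) := by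
      refine ContinuousOn.neg (ContinuousOn.mul continuousOn_const
        (ContinuousOn.rpow_const ?_ fun _ _ => Or.inr hγ.le))
      refine ContinuousOn.sub (continuousOn_const.div continuousOn_id ?_) continuousOn_const
      intro s hs
      exact (hε.trans_le hs.1).ne'
    have hder : ∀ s ∈ Ioo ε (min r τ), HasDerivAt (fun s => -(γ⁻¹ * τ⁻¹ * (τ / s - 1) ^ γ))
        (s ^ (-1 - γ) * (τ - s) ^ (γ - 1)) s := fun s hs =>
      hasDerivAt_div_sub_one_rpow hγ.ne' (hε.trans hs.1) (hs.2.trans_le (min_le_right _ _))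
    rw [intervalIntegral.integral_eq_sub_of_hasDerivAt_of_le hm hcont hder]
    · have b1 : 0 ≤ τ / ε - 1 := by rw [sub_nonneg, one_le_div hε]; exact h.le
      have b2 : τ / min r τ - 1 = max (τ / r - 1) 0 := by
        rcases le_total r τ with hh | hh
        · rw [min_eq_left hh, max_eq_left]
          rw [sub_nonneg, one_le_div hr]; exact hh
        · rw [min_eq_right hh, max_eq_right, div_self hτ.ne', sub_self]
          rw [sub_nonpos, div_le_one hr]; exact hh
      rw [b2, max_eq_left b1]
      ring
    · rw [intervalIntegrable_iff_integrableOn_Ioc_of_le hm]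
      refine intervalIntegral.integrableOn_deriv_of_nonneg hcont hder ?_
      intro s hs
      have : s < τ := hs.2.trans_le (min_le_right _ _)
      exact mul_nonneg (Real.rpow_nonneg (hε.trans hs.1).le _)
        (Real.rpow_nonneg (by linarith) _)

lemma integral_indicator_rpow {γ ε r : ℝ} (hγ : 0 < γ) (hε : 0 < ε) (hεr : ε < r) :
    ∫ s, (Ioc ε r).indicator (fun s => s ^ (-1 - γ)) s = γ⁻¹ * ((ε ^ γ)⁻¹ - (r ^ γ)⁻¹) := by
  have hr : 0 < r := hε.trans hεr
  rw [integral_indicator measurableSet_Ioc, ← intervalIntegral.integral_of_le hεr.le,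
    integral_rpow]
  · have : -1 - γ + 1 = -γ := by ring
    rw [this, Real.rpow_neg hr.le, Real.rpow_neg hε.le]
    field_simp
    ring
  · right
    refine ⟨by linarith, ?_⟩
    rw [uIcc_of_le hεr.le]
    exact fun h => by linarith [h.1]

lemma abelKernel_div {γ τ ε : ℝ} (hτ : 0 < τ) (hε : 0 < ε) :
    ε⁻¹ * abelKernel γ (τ / ε) = τ⁻¹ * (τ ^ γ * (ε ^ γ)⁻¹ - (max (τ / ε - 1) 0) ^ γ) := by
  unfold abelKernel
  rw [Real.div_rpow hτ.le hε.le]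
  field_simp

lemma abelInt_sub_eq_integral_indicator (γ : ℝ) (φ : ℝ → ℝ) {t s : ℝ} (hs : 0 ≤ s) (hst : s ≤ t) :
    abelInt γ φ (t - s) = ∫ τ, (Ioo 0 t).indicator (fun τ => φ (t - τ)) τ *
      (Ioo 0 t).indicator (fun z => z ^ (γ - 1)) (τ - s) := by
  have h1 : (fun τ => (Ioo 0 t).indicator (fun τ => φ (t - τ)) τ *
      (Ioo 0 t).indicator (fun z => z ^ (γ - 1)) (τ - s)) =
      (Ioo s t).indicator (fun τ => (t - s - (t - τ)) ^ (γ - 1) * φ (t - τ)) := by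
    ext τ
    by_cases h : τ ∈ Ioo s t
    · have a1 : τ ∈ Ioo 0 t := ⟨hs.trans_lt h.1, h.2⟩
      have a2 : τ - s ∈ Ioo 0 t := ⟨by linarith [h.1], by linarith [h.2]⟩
      rw [indicator_of_mem h, indicator_of_mem a1, indicator_of_mem a2, mul_comm]
      congr 2
      ring
    · rw [indicator_of_notMem h]
      by_cases a1 : τ ∈ Ioo 0 t
      · have a2 : τ - s ∉ Ioo 0 t := fun a2 => h ⟨by linarith [a2.1], a1.2⟩
        rw [indicator_of_notMem a2, mul_zero]
      · rw [indicator_of_notMem a1, zero_mul]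
  rw [h1, integral_indicator measurableSet_Ioo, ← integral_Ioc_eq_integral_Ioo,
    ← intervalIntegral.integral_of_le hst, abelInt,
    intervalIntegral.integral_comp_sub_left (fun σ => (t - s - σ) ^ (γ - 1) * φ σ) t, sub_self]

/-- Extremum principle: the Abel integral of a nonnegative continuous function vanishing at `t`
cannot have a positive derivative at `t`. -/
lemma hasDerivAt_abelInt_nonpos {γ t L : ℝ} {φ : ℝ → ℝ} (hγ : 0 < γ) (hγ1 : γ < 1) (ht : 0 < t)
    (hφ : ContinuousOn φ (Icc 0 t)) (hφ0 : ∀ s ∈ Icc 0 t, 0 ≤ φ s) (hφt : φ t = 0)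
    (hL : HasDerivAt (abelInt γ φ) L t) : L ≤ 0 := by
  by_contra! hLpos
  obtain ⟨r, hr, hrt, hdiff⟩ : ∃ r > 0, r < t ∧ ∀ s ∈ Ioc 0 r,
      L / 2 * s ≤ abelInt γ φ t - abelInt γ φ (t - s) := by
    have h1 := (hasDerivAt_iff_isLittleO.1 hL).def (half_pos hLpos)
    obtain ⟨d, hd, hball⟩ := Metric.eventually_nhds_iff.1 h1
    refine ⟨min (d / 2) (t / 2), by positivity, (min_le_right _ _).trans_lt (by linarith), ?_⟩
    intro s hs
    have hs1 : s ≤ d / 2 := hs.2.trans (min_le_left _ _)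
    have h2 := hball (y := t - s) (by rw [Real.dist_eq, abs_lt]; constructor <;> linarith [hs.1])
    have h3 : t - s - t = -s := by ring
    rw [h3, norm_neg, Real.norm_of_nonneg hs.1.le, smul_eq_mul, Real.norm_eq_abs] at h2
    have := (abs_le.1 h2).2
    nlinarith
  set Ψ : ℝ → ℝ := (Ioo 0 t).indicator (fun τ => φ (t - τ)) with hΨ
  set k : ℝ → ℝ := (Ioo 0 t).indicator (fun z => z ^ (γ - 1)) with hk
  have hmaps : MapsTo (fun τ => t - τ) (Icc 0 t) (Icc 0 t) := fun τ hτ =>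
    ⟨by linarith [hτ.2], by linarith [hτ.1]⟩
  have hφc : ContinuousOn (fun τ => φ (t - τ)) (Icc 0 t) :=
    hφ.comp (by fun_prop) hmaps
  have hΨm : AEStronglyMeasurable Ψ volume :=
    (aestronglyMeasurable_indicator_iff measurableSet_Ioo).2
      ((hφc.mono Ioo_subset_Icc_self).aestronglyMeasurable measurableSet_Ioo)
  obtain ⟨M, hM⟩ := isCompact_Icc.exists_bound_of_continuousOn hφ
  have hM0 : 0 ≤ M := (norm_nonneg _).trans (hM t ⟨ht.le, le_rfl⟩)
  have hΨ0 : ∀ τ, 0 ≤ Ψ τ := fun τ =>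
    indicator_nonneg (fun τ hτ => hφ0 _ (hmaps (Ioo_subset_Icc_self hτ))) τ
  have hΨM : ∀ τ, ‖Ψ τ‖ ≤ M := fun τ => by
    by_cases h : τ ∈ Ioo 0 t
    · rw [hΨ, indicator_of_mem h]; exact hM _ (hmaps (Ioo_subset_Icc_self h))
    · rw [hΨ, indicator_of_notMem h, norm_zero]; exact hM0
  have hkint : Integrable k := by
    rw [hk, integrable_indicator_iff measurableSet_Ioo]
    exact ((intervalIntegrable_iff_integrableOn_Ioc_of_le ht.le).1
      (intervalIntegral.intervalIntegrable_rpow' (by linarith))).mono_set Ioo_subset_Ioc_self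
  have hJ : ∀ s, 0 ≤ s → s ≤ t → abelInt γ φ (t - s) = ∫ τ, Ψ τ * k (τ - s) :=
    fun s hs hst => abelInt_sub_eq_integral_indicator γ φ hs hst
  have hJt : abelInt γ φ t = ∫ τ, Ψ τ * k τ := by simpa using hJ 0 le_rfl ht.le
  -- the averaged difference quotient is controlled by the kernel
  have key : ∀ ε ∈ Ioo 0 (r / 2), L / 2 * (r ^ (-γ) * (r / 2)) ≤
      γ⁻¹ * ∫ z in Ioi 0, Ψ (ε * z) * abelKernel γ z := by
    intro ε hε
    have hε0 : 0 < ε := hε.1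
    have hεr : ε < r := by linarith [hε.2]
    set f : ℝ → ℝ := (Ioc ε r).indicator (fun s => s ^ (-1 - γ)) with hf
    have hfint : Integrable f := by
      rw [hf, integrable_indicator_iff measurableSet_Ioc]
      refine (ContinuousOn.integrableOn_Icc ?_).mono_set Ioc_subset_Icc_self
      exact ContinuousOn.rpow_const continuousOn_id fun s hs =>
        Or.inl (hε0.trans_le hs.1).ne'
    have hprod : Integrable (Function.uncurry fun τ s => Ψ τ * (f s * k (τ - s)))
        (volume.prod volume) := by
      have h1 := hfint.convolution_integrand (ContinuousLinearMap.mul ℝ ℝ) hkint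
        (μ := volume) (ν := volume)
      exact Integrable.bdd_mul (c := M) h1 hΨm.comp_fst (ae_of_all _ fun p => hΨM _)
    have hswap := integral_integral_swap hprod
    have hfst : ∫ τ, ∫ s, Ψ τ * (f s * k (τ - s)) = ∫ τ, Ψ τ * ∫ s, f s * k (τ - s) := by
      simp_rw [integral_const_mul]
    have hsnd : ∀ s, ∫ τ, Ψ τ * (f s * k (τ - s)) = f s * abelInt γ φ (t - s) := by
      intro s
      by_cases hs : s ∈ Ioc ε r
      · rw [hJ s (hε0.trans hs.1).le (by linarith [hs.2]), ← integral_const_mul]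
        congr 1
        ext τ
        ring
      · simp [hf, hs]
    have hint2 : Integrable (fun s => f s * abelInt γ φ (t - s)) := by
      have := hprod.integral_prod_right
      simpa only [Function.uncurry, hsnd] using this
    have hint1 : Integrable (fun τ => Ψ τ * ∫ s, f s * k (τ - s)) := by
      have := hprod.integral_prod_left
      simpa only [Function.uncurry, integral_const_mul] using this
    have hlow : L / 2 * (r ^ (-γ) * (r / 2)) ≤
        ∫ s, (f s * abelInt γ φ t - f s * abelInt γ φ (t - s)) := by
      have h1 : L / 2 * (r ^ (-γ) * (r / 2)) =
          ∫ s, (Ioc (r / 2) r).indicator (fun _ => L / 2 * r ^ (-γ)) s := by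
        rw [integral_indicator measurableSet_Ioc, setIntegral_const]
        simp only [Real.volume_real_Ioc, smul_eq_mul]
        rw [max_eq_left (by linarith)]
        ring
      rw [h1]
      refine integral_mono ?_ ((hfint.mul_const _).sub hint2) ?_
      · rw [integrable_indicator_iff measurableSet_Ioc]
        exact integrableOn_const (by simp)
      · intro s
        show _ ≤ f s * abelInt γ φ t - f s * abelInt γ φ (t - s)
        rw [← mul_sub]
        by_cases hs : s ∈ Ioc ε r
        · have hs0 : 0 < s := hε0.trans hs.1
          have h2 : L / 2 * r ^ (-γ) ≤ f s * (abelInt γ φ t - abelInt γ φ (t - s)) := by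
            have h3 := mul_le_mul_of_nonneg_left (hdiff s ⟨hs0, hs.2⟩)
              (Real.rpow_nonneg hs0.le (-1 - γ))
            rw [hf, indicator_of_mem hs]
            refine le_trans ?_ h3
            have h4 : s ^ (-γ) = s ^ (-1 - γ) * s := by
              rw [← Real.rpow_add_one hs0.ne']; congr 1; ring
            have h5 : r ^ (-γ) ≤ s ^ (-γ) :=
              Real.rpow_le_rpow_of_nonpos hs0 hs.2 (by linarith)
            have h6 := mul_le_mul_of_nonneg_left h5 (half_pos hLpos).le
            rw [h4] at h6
            linarith
          refine le_trans (indicator_le_self' ?_ s) h2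
          intro _ _
          positivity
        · have : s ∉ Ioc (r / 2) r := fun h => hs ⟨hε.2.trans h.1, h.2⟩
          rw [hf, indicator_of_notMem hs, indicator_of_notMem this, zero_mul]
    have hsub : ∫ s, (f s * abelInt γ φ t - f s * abelInt γ φ (t - s)) =
        ∫ τ, Ψ τ * ((∫ s, f s) * k τ - ∫ s, f s * k (τ - s)) := by
      rw [integral_sub (hfint.mul_const _) hint2, integral_mul_const]
      simp_rw [← hsnd]
      rw [← hswap, hfst, hJt, ← integral_const_mul, ← integral_sub _ hint1]
      · congr 1
        ext τ
        ring
      · exact (Integrable.bdd_mul hkint hΨm (ae_of_all _ hΨM)).const_mul _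
    have hQint : IntegrableOn (fun z => Ψ (ε * z) * abelKernel γ z) (Ioi 0) := by
      refine Integrable.bdd_mul (c := M) (integrableOn_abelKernel hγ hγ1) ?_
        (ae_of_all _ fun z => hΨM _)
      exact (hΨm.comp_quasiMeasurePreserving
        (Measure.quasiMeasurePreserving_smul volume hε0.ne')).restrict
    have hscale : ∫ z in Ioi 0, Ψ (ε * z) * abelKernel γ z =
        ∫ τ in Ioi 0, Ψ τ * (ε⁻¹ * abelKernel γ (τ / ε)) := by
      have h1 := integral_comp_mul_left_Ioi (fun τ => Ψ τ * abelKernel γ (τ / ε)) 0 hε0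
      simp only [mul_zero, smul_eq_mul, mul_div_cancel_left₀ _ hε0.ne'] at h1
      rw [h1, ← integral_const_mul]
      congr 1
      ext τ
      ring
    have hscaleint : IntegrableOn (fun τ => Ψ τ * (ε⁻¹ * abelKernel γ (τ / ε))) (Ioi 0) := by
      have h1 : IntegrableOn (fun τ => Ψ τ * abelKernel γ (τ / ε)) (Ioi 0) := by
        have := integrableOn_Ioi_comp_mul_left_iff (fun τ => Ψ τ * abelKernel γ (τ / ε)) 0 hε0
        simp only [mul_zero, mul_div_cancel_left₀ _ hε0.ne'] at this
        exact this.1 hQint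
      refine (h1.const_mul ε⁻¹).congr (ae_of_all _ fun τ => ?_)
      ring
    rw [hscale, ← integral_const_mul, ← integral_indicator measurableSet_Ioi]
    refine hlow.trans (hsub.le.trans ?_)
    refine integral_mono ?_ ?_ ?_
    · have h1 : Integrable (fun τ => (∫ s, f s) * (Ψ τ * k τ) - Ψ τ * ∫ s, f s * k (τ - s)) :=
        ((Integrable.bdd_mul hkint hΨm (ae_of_all _ hΨM)).const_mul _).sub hint1
      refine h1.congr (ae_of_all _ fun τ => ?_)
      ring
    · rw [integrable_indicator_iff measurableSet_Ioi]
      exact hscaleint.const_mul _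
    · intro τ
      by_cases hτ : τ ∈ Ioo 0 t
      · have hτ0 : 0 < τ := hτ.1
        have h1 : (∫ s, f s * k (τ - s)) = _ :=
          integral_indicator_rpow_mul hγ hγ1 hε0 hεr hτ.2 hτ0
        have h2 : (∫ s, f s) = _ := integral_indicator_rpow hγ hε0 hεr
        show Ψ τ * ((∫ s, f s) * k τ - ∫ s, f s * k (τ - s)) ≤ _
        rw [indicator_of_mem (show τ ∈ Ioi 0 from hτ0), h1, h2, hk, indicator_of_mem hτ]
        have h3 := abelKernel_div (γ := γ) hτ0 hε0
        have h4 := abelKernel_div (γ := γ) hτ0 hr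
        have h5 : 0 ≤ r⁻¹ * abelKernel γ (τ / r) :=
          mul_nonneg (inv_nonneg.2 hr.le) (abelKernel_nonneg hγ (div_pos hτ0 hr))
        have h6 : γ⁻¹ * ((ε ^ γ)⁻¹ - (r ^ γ)⁻¹) * τ ^ (γ - 1) -
            γ⁻¹ * τ⁻¹ * ((max (τ / ε - 1) 0) ^ γ - (max (τ / r - 1) 0) ^ γ) =
            γ⁻¹ * (ε⁻¹ * abelKernel γ (τ / ε) - r⁻¹ * abelKernel γ (τ / r)) := by
          rw [h3, h4, Real.rpow_sub_one hτ0.ne']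
          ring
        rw [h6]
        have h7 : γ⁻¹ * (Ψ τ * (ε⁻¹ * abelKernel γ (τ / ε))) =
          Ψ τ * (γ⁻¹ * (ε⁻¹ * abelKernel γ (τ / ε))) := by ring
        rw [h7]
        refine mul_le_mul_of_nonneg_left ?_ (hΨ0 τ)
        exact mul_le_mul_of_nonneg_left (by linarith) (inv_nonneg.2 hγ.le)
      · have : Ψ τ = 0 := indicator_of_notMem hτ _
        show Ψ τ * _ ≤ _
        rw [this, zero_mul]
        refine indicator_nonneg (fun τ hτ => ?_) τ
        exact mul_nonneg (inv_nonneg.2 hγ.le) (mul_nonneg (hΨ0 _)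
          (mul_nonneg (inv_nonneg.2 hε0.le) (abelKernel_nonneg hγ (div_pos hτ hε0))))
  have hlim : Tendsto (fun ε => γ⁻¹ * ∫ z in Ioi 0, Ψ (ε * z) * abelKernel γ z)
      (nhdsWithin 0 (Ioi 0)) (nhds (γ⁻¹ * ∫ _ in Ioi (0:ℝ), (0:ℝ))) := by
    refine Tendsto.const_mul _ ?_
    refine tendsto_integral_filter_of_dominated_convergence (fun z => M * abelKernel γ z) ?_ ?_
      ((integrableOn_abelKernel hγ hγ1).const_mul M) ?_
    · filter_upwards [self_mem_nhdsWithin] with ε hε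
      refine AEStronglyMeasurable.mul ?_ (measurable_abelKernel γ).aestronglyMeasurable
      exact (hΨm.comp_quasiMeasurePreserving
        (Measure.quasiMeasurePreserving_smul volume (ne_of_gt hε))).restrict
    · refine Eventually.of_forall fun ε => ?_
      filter_upwards [ae_restrict_mem measurableSet_Ioi] with z hz
      have h0 := abelKernel_nonneg hγ hz
      rw [norm_mul, Real.norm_of_nonneg h0]
      exact mul_le_mul_of_nonneg_right (hΨM _) h0
    · filter_upwards [ae_restrict_mem measurableSet_Ioi] with z hz
      have hz0 : (0:ℝ) < z := hz
      have h1 : Tendsto Ψ (nhdsWithin 0 (Ioi 0)) (nhds 0) := by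
        have h2 : Tendsto (fun τ => φ (t - τ)) (nhdsWithin 0 (Ioo 0 t)) (nhds 0) := by
          have := (hφc 0 ⟨le_rfl, ht.le⟩).mono_left (nhdsWithin_mono _ Ioo_subset_Icc_self)
          simpa [hφt] using this
        rw [nhdsWithin_Ioo_eq_nhdsGT ht] at h2
        refine h2.congr' ?_
        filter_upwards [Ioo_mem_nhdsGT ht] with τ hτ
        rw [hΨ, indicator_of_mem hτ]
      have h3 : Tendsto (fun ε : ℝ => ε * z) (nhdsWithin 0 (Ioi 0)) (nhdsWithin 0 (Ioi 0)) := by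
        refine tendsto_nhdsWithin_iff.2 ⟨?_, ?_⟩
        · have : Tendsto (fun ε : ℝ => ε * z) (nhds 0) (nhds (0 * z)) :=
            tendsto_id.mul_const z
          rw [zero_mul] at this
          exact this.mono_left nhdsWithin_le_nhds
        · filter_upwards [self_mem_nhdsWithin] with ε hε
          exact mul_pos hε hz0
      simpa using (h1.comp h3).mul_const (abelKernel γ z)
  rw [integral_zero, mul_zero] at hlim
  have hle : L / 2 * (r ^ (-γ) * (r / 2)) ≤ 0 := by
    refine ge_of_tendsto hlim ?_
    filter_upwards [Ioo_mem_nhdsGT (half_pos hr)] with ε hε using key ε hε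
  have : 0 < L / 2 * (r ^ (-γ) * (r / 2)) := by positivity
  linarith

lemma abelInt_eq_integral_comp_sub (γ : ℝ) (F : ℝ → ℝ) (t : ℝ) :
    abelInt γ F t = ∫ s in (0:ℝ)..t, s ^ (γ - 1) * F (t - s) := by
  have := intervalIntegral.integral_comp_sub_left (a := 0) (b := t)
    (fun s => (t - s) ^ (γ - 1) * F s) t
  simpa [abelInt] using this.symm

lemma intervalIntegrable_abel {γ t : ℝ} {F : ℝ → ℝ} (hγ : 0 < γ) (ht : 0 ≤ t)
    (hF : ContinuousOn F (Icc 0 t)) :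
    IntervalIntegrable (fun s => (t - s) ^ (γ - 1) * F s) volume 0 t := by
  refine IntervalIntegrable.mul_continuousOn ?_ (by rwa [uIcc_of_le ht])
  have h : IntervalIntegrable (fun s : ℝ => s ^ (γ - 1)) volume t 0 :=
    intervalIntegral.intervalIntegrable_rpow' (by linarith)
  simpa using h.comp_sub_left t

lemma abelInt_one {γ t : ℝ} (hγ : 0 < γ) : abelInt γ (fun _ => 1) t = t ^ γ / γ := by
  rw [abelInt_eq_integral_comp_sub]
  simp only [mul_one]
  rw [integral_rpow (Or.inl (by linarith))]
  simp [Real.zero_rpow hγ.ne']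

lemma abelInt_rpow {γ p t : ℝ} (ht : 0 < t) :
    abelInt γ (fun s => s ^ p) t = t ^ (p + γ) * abelInt γ (fun s => s ^ p) 1 := by
  have h := intervalIntegral.smul_integral_comp_mul_left (a := 0) (b := 1)
    (fun s => (t - s) ^ (γ - 1) * s ^ p) t
  simp only [mul_zero, mul_one, smul_eq_mul] at h
  rw [abelInt, ← h, abelInt, ← intervalIntegral.integral_const_mul,
    ← intervalIntegral.integral_const_mul]
  refine intervalIntegral.integral_congr fun s hs => ?_
  rw [uIcc_of_le zero_le_one] at hs
  have h1 : t - t * s = t * (1 - s) := by ring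
  have h2 : t ^ (p + γ) = t * (t ^ (γ - 1) * t ^ p) := by
    rw [← Real.rpow_add ht, mul_comm, ← Real.rpow_add_one ht.ne']
    congr 1
    ring
  rw [h1, Real.mul_rpow ht.le (by linarith [hs.2]), Real.mul_rpow ht.le hs.1, h2]
  ring

lemma abelInt_rpow_one_nonneg (γ p : ℝ) : 0 ≤ abelInt γ (fun s => s ^ p) 1 := by
  refine intervalIntegral.integral_nonneg zero_le_one fun s hs => ?_
  exact mul_nonneg (Real.rpow_nonneg (by linarith [hs.2]) _) (Real.rpow_nonneg hs.1 _)

lemma hasDerivAt_abelInt_rpow {γ p t : ℝ} (ht : 0 < t) :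
    HasDerivAt (abelInt γ (fun s => s ^ p))
      ((p + γ) * t ^ (p + γ - 1) * abelInt γ (fun s => s ^ p) 1) t := by
  refine HasDerivAt.congr_of_eventuallyEq
    ((Real.hasDerivAt_rpow_const (Or.inl ht.ne')).mul_const _) ?_
  filter_upwards [Ioi_mem_nhds ht] with τ hτ using abelInt_rpow hτ

/-- Differentiation of an Abel integral with continuously differentiable density. -/
lemma hasDerivAt_abelInt {γ t : ℝ} {F F' : ℝ → ℝ} (hγ : 0 < γ) (ht : 0 < t)
    (hF : ∀ s ∈ Ici (0:ℝ), HasDerivWithinAt F (F' s) (Ici 0) s)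
    (hF' : ContinuousOn F' (Ici 0)) :
    HasDerivAt (abelInt γ F) (F 0 * t ^ (γ - 1) + abelInt γ F' t) t := by
  have hFc : ContinuousOn F (Ici 0) := fun s hs => (hF s hs).continuousWithinAt
  set E : ℝ → ℝ := fun z => F (max z 0) - F 0 with hE
  have hEc : Continuous E := by
    refine Continuous.sub ?_ continuous_const
    exact hFc.comp_continuous (by fun_prop) fun z => le_max_right z 0
  have hEneg : ∀ z ≤ 0, E z = 0 := fun z hz => by simp [hE, max_eq_right hz]
  have hEpos : ∀ z, 0 ≤ z → E z = F z - F 0 := fun z hz => by simp [hE, max_eq_left hz]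
  set T : ℝ := t + 1 with hT
  have hT0 : 0 < T := by linarith
  have hrpow : ∀ a b : ℝ, IntervalIntegrable (fun s : ℝ => s ^ (γ - 1)) volume a b := fun a b =>
    intervalIntegral.intervalIntegrable_rpow' (by linarith)
  have hrE : ∀ τ a b : ℝ,
      IntervalIntegrable (fun s : ℝ => s ^ (γ - 1) * E (τ - s)) volume a b := fun τ a b =>
    (hrpow a b).mul_continuousOn (by fun_prop)
  have hsplit : ∀ τ ∈ Ioo 0 T, abelInt γ F τ =
      F 0 * (τ ^ γ / γ) + ∫ s in (0:ℝ)..T, s ^ (γ - 1) * E (τ - s) := by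
    intro τ hτ
    have h1 : ∫ s in τ..T, s ^ (γ - 1) * E (τ - s) = 0 := by
      rw [← intervalIntegral.integral_zero (a := τ) (b := T)]
      refine intervalIntegral.integral_congr fun s hs => ?_
      rw [uIcc_of_le hτ.2.le] at hs
      rw [hEneg _ (by linarith [hs.1]), mul_zero]
    rw [← intervalIntegral.integral_add_adjacent_intervals (hrE τ 0 τ) (hrE τ τ T), h1, add_zero,
      ← abelInt_one hγ, abelInt_eq_integral_comp_sub, abelInt_eq_integral_comp_sub,
      ← intervalIntegral.integral_const_mul, ← intervalIntegral.integral_add _ (hrE τ 0 τ)]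
    · refine intervalIntegral.integral_congr fun s hs => ?_
      rw [uIcc_of_le hτ.1.le] at hs
      rw [hEpos _ (by linarith [hs.2])]
      ring
    · simpa using (hrpow 0 τ).const_mul (F 0)
  obtain ⟨C, hC⟩ := (isCompact_Icc (a := (0:ℝ)) (b := T)).exists_bound_of_continuousOn
    (hF'.mono Icc_subset_Ici_self)
  have hC0 : 0 ≤ C := (norm_nonneg _).trans (hC 0 ⟨le_rfl, hT0.le⟩)
  have hFlip : ∀ z ∈ Icc 0 T, ∀ w ∈ Icc 0 T, |F z - F w| ≤ C * |z - w| := by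
    intro z hz w hw
    exact (convex_Icc (0:ℝ) T).norm_image_sub_le_of_norm_hasDerivWithin_le
      (fun s hs => (hF s hs.1).mono Icc_subset_Ici_self) hC hw hz
  have hElip : ∀ z ≤ T, ∀ w ≤ T, |E z - E w| ≤ C * |z - w| := by
    intro z hz w hw
    have h1 := hFlip (max z 0) ⟨le_max_right _ _, max_le hz hT0.le⟩ (max w 0)
      ⟨le_max_right _ _, max_le hw hT0.le⟩
    have h2 : |max z 0 - max w 0| ≤ |z - w| := abs_max_sub_max_le_abs z w 0
    have h3 : E z - E w = F (max z 0) - F (max w 0) := by simp [hE]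
    rw [h3]
    exact h1.trans (mul_le_mul_of_nonneg_left h2 hC0)
  set D : ℝ → ℝ := (Ioo 0 t).indicator (fun s => F' (t - s)) with hD
  have hmain := intervalIntegral.hasDerivAt_integral_of_dominated_loc_of_lip
    (μ := volume) (𝕜 := ℝ) (a := 0) (b := T) (x₀ := t) (s := Iio T)
    (F := fun τ s => s ^ (γ - 1) * E (τ - s)) (F' := fun s => s ^ (γ - 1) * D s)
    (bound := fun s => s ^ (γ - 1) * C) (Iio_mem_nhds (by linarith)) ?_ (hrE t 0 T) ?_ ?_ ?_ ?_
  · have h1 : ∫ s in (0:ℝ)..T, s ^ (γ - 1) * D s = abelInt γ F' t := by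
      rw [abelInt_eq_integral_comp_sub, intervalIntegral.integral_of_le hT0.le,
        intervalIntegral.integral_of_le ht.le]
      have h2 : (fun s => s ^ (γ - 1) * D s) =
          (Ioo 0 t).indicator (fun s => s ^ (γ - 1) * F' (t - s)) := by
        ext s
        by_cases hs : s ∈ Ioo 0 t
        · simp only [hD, indicator_of_mem hs]
        · simp only [hD, indicator_of_notMem hs, mul_zero]
      rw [h2, setIntegral_indicator measurableSet_Ioo, integral_Ioc_eq_integral_Ioo]
      congr 2
      refine inter_eq_right.2 fun s hs => ⟨hs.1, by linarith [hs.2]⟩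
    have h3 := hmain.2
    rw [h1] at h3
    have h4 : HasDerivAt (fun τ => F 0 * (τ ^ γ / γ)) (F 0 * t ^ (γ - 1)) t := by
      refine (((Real.hasDerivAt_rpow_const (p := γ) (Or.inl ht.ne')).div_const γ).const_mul
        (F 0)).congr_deriv ?_
      field_simp
    refine (h4.add h3).congr_of_eventuallyEq ?_
    filter_upwards [Ioo_mem_nhds ht (show t < T by linarith)] with τ hτ using hsplit τ hτ
  · exact Eventually.of_forall fun τ => 
      (intervalIntegrable_iff.1 (hrE τ 0 T)).aestronglyMeasurable
  · refine AEStronglyMeasurable.mul (intervalIntegrable_iff.1 (hrpow 0 T)).aestronglyMeasurable ?_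
    refine AEStronglyMeasurable.restrict ?_
    rw [hD, aestronglyMeasurable_indicator_iff measurableSet_Ioo]
    refine ContinuousOn.aestronglyMeasurable ?_ measurableSet_Ioo
    exact hF'.comp (by fun_prop) fun s hs => by
      have := hs.2
      simp only [mem_Ici]
      linarith
  · refine ae_of_all _ fun s hs => ?_
    rw [uIoc_of_le hT0.le] at hs
    refine LipschitzOnWith.of_dist_le_mul fun z hz w hw => ?_
    have h0 : 0 ≤ s ^ (γ - 1) := Real.rpow_nonneg hs.1.le _
    have hz' : z < T := hz
    have hw' : w < T := hw
    have h1 := hElip (z - s) (by linarith [hs.1]) (w - s) (by linarith [hs.1])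
    rw [Real.dist_eq, Real.dist_eq, ← mul_sub, abs_mul, abs_of_nonneg h0, Real.coe_nnabs,
      abs_of_nonneg (mul_nonneg h0 hC0), mul_assoc]
    refine mul_le_mul_of_nonneg_left ?_ h0
    simpa using h1
  · exact (hrpow 0 T).mul_const C
  · have hne : ∀ᵐ s : ℝ, s ≠ t := by simp [ae_iff]
    filter_upwards [hne] with s hst hs
    rw [uIoc_of_le hT0.le] at hs
    refine HasDerivAt.const_mul _ ?_
    have key : HasDerivAt E (D s) (t - s) := by
      rcases lt_or_gt_of_ne hst with h | h
      · rw [hD, indicator_of_mem (show s ∈ Ioo 0 t from ⟨hs.1, h⟩)]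
        have h1 := ((hF (t - s) (by simp only [mem_Ici]; linarith)).hasDerivAt
          (Ici_mem_nhds (by linarith))).sub_const (F 0)
        refine h1.congr_of_eventuallyEq ?_
        filter_upwards [Ioi_mem_nhds (show 0 < t - s by linarith)] with z hz
        exact hEpos z (le_of_lt hz)
      · rw [hD, indicator_of_notMem (fun h' => by linarith [h'.2])]
        refine (hasDerivAt_const (t - s) (0:ℝ)).congr_of_eventuallyEq ?_
        filter_upwards [Iio_mem_nhds (show t - s < 0 by linarith)] with z hz
        exact hEneg z (le_of_lt hz)
    exact key.comp_sub_const t s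

lemma hasDerivWithinAt_iteratedDerivWithin {m : ℕ} {F : ℝ → ℝ}
    (hF : ContDiffOn ℝ (m + 1 : ℕ) F (Ici 0)) {s : ℝ} (hs : s ∈ Ici (0:ℝ)) :
    HasDerivWithinAt (iteratedDerivWithin m F (Ici 0)) (iteratedDerivWithin (m + 1) F (Ici 0) s)
      (Ici 0) s := by
  rw [iteratedDerivWithin_succ]
  refine DifferentiableWithinAt.hasDerivWithinAt ?_
  exact hF.differentiableOn_iteratedDerivWithin (by exact_mod_cast Nat.lt_succ_self m)
    (uniqueDiffOn_Ici 0) s hs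

/-- Iterated derivatives of an Abel integral: up to singular powers, they pass to the density. -/
lemma exists_iteratedDeriv_abelInt_eq {γ : ℝ} (hγ : 0 < γ) {m : ℕ} {F : ℝ → ℝ}
    (hF : ContDiffOn ℝ m F (Ici 0)) :
    ∃ c : ℕ → ℝ, ∀ t > 0, iteratedDeriv m (abelInt γ F) t =
      abelInt γ (iteratedDerivWithin m F (Ici 0)) t +
        ∑ k ∈ Finset.range m, c k * t ^ (γ - 1 - k) := by
  induction m with
  | zero => exact ⟨0, fun t _ => by simp⟩
  | succ m ih =>
    obtain ⟨c, hc⟩ := ih (hF.of_le (by exact_mod_cast Nat.le_succ m))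
    set G := iteratedDerivWithin m F (Ici 0) with hG
    refine ⟨fun k => Nat.casesOn k (G 0) fun j => c j * (γ - 1 - j), fun t ht => ?_⟩
    have h1 := hasDerivAt_abelInt hγ ht (fun s hs => hasDerivWithinAt_iteratedDerivWithin hF hs)
      (hF.continuousOn_iteratedDerivWithin le_rfl (uniqueDiffOn_Ici 0))
    have h2 : HasDerivAt (fun t : ℝ => ∑ k ∈ Finset.range m, c k * t ^ (γ - 1 - k))
        (∑ k ∈ Finset.range m, c k * ((γ - 1 - k) * t ^ (γ - 1 - k - 1))) t :=
      HasDerivAt.fun_sum fun k _ => (Real.hasDerivAt_rpow_const (Or.inl ht.ne')).const_mul _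
    have h3 : HasDerivAt (iteratedDeriv m (abelInt γ F)) _ t :=
      (h1.add h2).congr_of_eventuallyEq (by filter_upwards [Ioi_mem_nhds ht] with τ hτ using hc τ hτ)
    rw [iteratedDeriv_succ, h3.deriv, Finset.sum_range_succ', ← hG]
    simp only [Nat.cast_zero, sub_zero]
    rw [add_comm (G 0 * _), add_assoc, add_comm (G 0 * _)]
    congr 2
    refine Finset.sum_congr rfl fun k _ => ?_
    rw [Nat.cast_succ, mul_assoc, sub_sub _ (k : ℝ) 1]

lemma abelInt_const_sub {γ p V τ : ℝ} {G : ℝ → ℝ} (hγ : 0 < γ) (hp : 0 < p) (hτ : 0 ≤ τ)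
    (hG : ContinuousOn G (Ici 0)) :
    abelInt γ (fun s => V - (G s + s ^ p)) τ =
      V * (τ ^ γ / γ) - (abelInt γ G τ + abelInt γ (fun s => s ^ p) τ) := by
  have h1 := intervalIntegrable_abel hγ hτ (continuousOn_const (c := (1:ℝ)))
  have h2 := intervalIntegrable_abel hγ hτ (hG.mono Icc_subset_Ici_self)
  have h3 := intervalIntegrable_abel (F := fun s => s ^ p) hγ hτ
    (continuousOn_id.rpow_const fun _ _ => Or.inr hp.le)
  rw [← abelInt_one hγ]
  simp only [abelInt]
  rw [← intervalIntegral.integral_const_mul, ← intervalIntegral.integral_add h2 h3,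
    ← intervalIntegral.integral_sub (h1.const_mul V) (h2.add h3)]
  congr 1
  ext s
  ring

/-- At a running maximum of `F⁽ᵐ⁾ + s ^ p`, the derivative of order `m + 1` of the Abel integral
of `F` is bounded below by a power; this includes points where it is not differentiable. -/
lemma exists_le_iteratedDeriv_abelInt {γ p : ℝ} (hγ : 0 < γ) (hγ1 : γ < 1) (hp : 0 < p) {m : ℕ}
    {F : ℝ → ℝ} (hF : ContDiffOn ℝ m F (Ici 0)) :
    ∃ C, 0 ≤ C ∧ ∀ t ≥ 1, (∀ s ∈ Icc 0 t, iteratedDerivWithin m F (Ici 0) s + s ^ p ≤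
      iteratedDerivWithin m F (Ici 0) t + t ^ p) →
      -(C * t ^ (p + γ - 1)) ≤ iteratedDeriv (m + 1) (abelInt γ F) t := by
  obtain ⟨c, hc⟩ := exists_iteratedDeriv_abelInt_eq hγ hF
  set G := iteratedDerivWithin m F (Ici 0) with hG
  have hGc : ContinuousOn G (Ici 0) :=
    hF.continuousOn_iteratedDerivWithin le_rfl (uniqueDiffOn_Ici 0)
  set B := abelInt γ (fun s => s ^ p) 1 with hB
  have hB0 : 0 ≤ B := abelInt_rpow_one_nonneg γ p
  set S := ∑ k ∈ Finset.range m, |c k * (γ - 1 - k)| with hS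
  have hS0 : 0 ≤ S := Finset.sum_nonneg fun _ _ => abs_nonneg _
  refine ⟨|G 0| + (p + γ) * B + S, by positivity, fun t ht hmax => ?_⟩
  have ht0 : 0 < t := by linarith
  have hpow : 0 ≤ t ^ (p + γ - 1) := Real.rpow_nonneg ht0.le _
  rw [iteratedDeriv_succ]
  by_cases hd : DifferentiableAt ℝ (iteratedDeriv m (abelInt γ F)) t
  swap
  · rw [deriv_zero_of_not_differentiableAt hd, neg_nonpos]
    positivity
  set L := deriv (iteratedDeriv m (abelInt γ F)) t with hL
  set R := ∑ k ∈ Finset.range m, c k * ((γ - 1 - k) * t ^ (γ - 1 - k - 1)) with hR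
  have h2 : HasDerivAt (fun t : ℝ => ∑ k ∈ Finset.range m, c k * t ^ (γ - 1 - k)) R t :=
    HasDerivAt.fun_sum fun k _ => (Real.hasDerivAt_rpow_const (Or.inl ht0.ne')).const_mul _
  have hRle : |R| ≤ S * t ^ (p + γ - 1) := by
    rw [hS, Finset.sum_mul]
    refine (Finset.abs_sum_le_sum_abs _ _).trans (Finset.sum_le_sum fun k _ => ?_)
    rw [← mul_assoc, abs_mul, abs_of_nonneg (Real.rpow_nonneg ht0.le (γ - 1 - k - 1))]
    refine mul_le_mul_of_nonneg_left ?_ (abs_nonneg _)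
    refine Real.rpow_le_rpow_of_exponent_le ht ?_
    have : (0:ℝ) ≤ k := Nat.cast_nonneg k
    linarith
  have hGd : HasDerivAt (abelInt γ G) (L - R) t := by
    refine (hd.hasDerivAt.sub h2).congr_of_eventuallyEq ?_
    filter_upwards [Ioi_mem_nhds ht0] with τ hτ
    have := hc τ hτ
    simp only [Pi.sub_apply]
    linarith
  set V := G t + t ^ p with hV
  have hφd : HasDerivAt (abelInt γ (fun s => V - (G s + s ^ p)))
      (V * t ^ (γ - 1) - ((L - R) + (p + γ) * t ^ (p + γ - 1) * B)) t := by
    have h4 : HasDerivAt (fun τ => V * (τ ^ γ / γ)) (V * t ^ (γ - 1)) t := by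
      refine (((Real.hasDerivAt_rpow_const (p := γ) (Or.inl ht0.ne')).div_const γ).const_mul
        V).congr_deriv ?_
      field_simp
    refine (h4.sub (hGd.add (hasDerivAt_abelInt_rpow ht0))).congr_of_eventuallyEq ?_
    filter_upwards [Ioi_mem_nhds ht0] with τ hτ using abelInt_const_sub hγ hp (le_of_lt hτ) hGc
  have hφc : ContinuousOn (fun s => V - (G s + s ^ p)) (Icc 0 t) :=
    continuousOn_const.sub ((hGc.mono Icc_subset_Ici_self).add
      (continuousOn_id.rpow_const fun _ _ => Or.inr hp.le))
  have hle := hasDerivAt_abelInt_nonpos hγ hγ1 ht0 hφc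
    (fun s hs => sub_nonneg.2 (hmax s hs)) (sub_self _) hφd
  have hV0 : G 0 ≤ V := by
    have := hmax 0 ⟨le_rfl, ht0.le⟩
    rwa [Real.zero_rpow hp.ne', add_zero] at this
  have h5 : t ^ (γ - 1) ≤ t ^ (p + γ - 1) :=
    Real.rpow_le_rpow_of_exponent_le ht (by linarith)
  have h6 : 0 ≤ t ^ (γ - 1) := Real.rpow_nonneg ht0.le _
  have h7 : -(|G 0| * t ^ (p + γ - 1)) ≤ V * t ^ (γ - 1) := by
    have h8 := mul_le_mul_of_nonneg_left h5 (abs_nonneg (G 0))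
    have h9 := mul_le_mul_of_nonneg_right ((neg_abs_le (G 0)).trans hV0) h6
    linarith
  have h10 := (abs_le.1 hRle).1
  linarith

lemma iteratedDeriv_const_mul_apply (m : ℕ) (c : ℝ) (F : ℝ → ℝ) (t : ℝ) :
    iteratedDeriv m (fun s => c * F s) t = c * iteratedDeriv m F t := by
  induction m generalizing t with
  | zero => simp
  | succ m ih =>
    rw [iteratedDeriv_succ, iteratedDeriv_succ, funext ih, deriv_const_mul_field]

lemma exists_le_caputoD {α p : ℝ} {m : ℕ} (hp : 0 < p) (hα : (m : ℝ) < α)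
    (hceil : ⌈α⌉₊ = m + 1) {x : ℝ → ℝ}
    (hx : ContDiffOn ℝ m (fun s => x s - taylorPolyAt0 (m + 1) x s) (Ici 0)) :
    ∃ C, 0 ≤ C ∧ ∀ t ≥ 1,
      (∀ s ∈ Icc 0 t,
        iteratedDerivWithin m (fun s => x s - taylorPolyAt0 (m + 1) x s) (Ici 0) s + s ^ p ≤
        iteratedDerivWithin m (fun s => x s - taylorPolyAt0 (m + 1) x s) (Ici 0) t + t ^ p) →
      -(C * t ^ (p + m - α)) ≤ caputoD α x t := by
  set y : ℝ → ℝ := fun s => x s - taylorPolyAt0 (m + 1) x s with hy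
  have hcap : ∀ t, caputoD α x t =
      1 / Real.Gamma ((m + 1 : ℕ) - α) * iteratedDeriv (m + 1) (abelInt ((m + 1 : ℕ) - α) y) t := by
    intro t
    rw [← iteratedDeriv_const_mul_apply, caputoD, hceil]
    rfl
  have hle : α ≤ (m + 1 : ℕ) := hceil ▸ Nat.le_ceil α
  rcases hle.eq_or_lt with h | h
  · refine ⟨0, le_rfl, fun t _ _ => ?_⟩
    rw [hcap, h]
    simp
  · have hγ : 0 < ((m + 1 : ℕ) : ℝ) - α := by linarith
    have hγ1 : ((m + 1 : ℕ) : ℝ) - α < 1 := by push_cast; linarith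
    have hΓ : 0 < 1 / Real.Gamma ((m + 1 : ℕ) - α) := one_div_pos.2 (Real.Gamma_pos_of_pos hγ)
    obtain ⟨C, hC, hmax⟩ := exists_le_iteratedDeriv_abelInt hγ hγ1 hp hx
    refine ⟨1 / Real.Gamma ((m + 1 : ℕ) - α) * C, by positivity, fun t ht hm => ?_⟩
    have h1 := mul_le_mul_of_nonneg_left (hmax t ht hm) hΓ.le
    rw [hcap]
    refine le_trans (le_of_eq ?_) h1
    have h2 : p + (((m + 1 : ℕ) : ℝ) - α) - 1 = p + m - α := by push_cast; ring
    rw [h2]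
    ring

lemma exists_iteratedDeriv_sum_mul_pow_eq (m : ℕ) (c : ℕ → ℝ) :
    ∃ K, ∀ t : ℝ, iteratedDeriv m (fun t => ∑ k ∈ Finset.range (m + 1), c k * t ^ k) t = K := by
  induction m generalizing c with
  | zero => exact ⟨c 0, fun t => by simp⟩
  | succ m ih =>
    obtain ⟨K, hK⟩ := ih fun k => c (k + 1) * (k + 1)
    refine ⟨K, fun t => ?_⟩
    rw [iteratedDeriv_succ', ← hK t]
    congr 1
    ext s
    have h : HasDerivAt (fun t : ℝ => ∑ k ∈ Finset.range (m + 1 + 1), c k * t ^ k)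
        (∑ k ∈ Finset.range (m + 1 + 1), c k * (k * s ^ (k - 1))) s :=
      HasDerivAt.fun_sum fun k _ => (hasDerivAt_pow k s).const_mul _
    rw [h.deriv, Finset.sum_range_succ']
    simp [mul_assoc]

lemma eventually_le_neg_one_of_hasDerivWithinAt {F F' : ℝ → ℝ}
    (hF : ∀ s ∈ Ici (0:ℝ), HasDerivWithinAt F (F' s) (Ici 0) s)
    (hF' : ∀ᶠ t in atTop, F' t ≤ -1) : ∀ᶠ t in atTop, F t ≤ -1 := by
  obtain ⟨T, hT⟩ := eventually_atTop.1 (hF'.and (eventually_gt_atTop 0))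
  have hT0 : 0 < T := (hT T le_rfl).2
  have hder : ∀ s ≥ T, HasDerivAt F (F' s) s := fun s hs =>
    (hF s (hT0.le.trans hs)).hasDerivAt (Ici_mem_nhds (hT0.trans_le hs))
  filter_upwards [eventually_ge_atTop (T + |F T| + 1)] with t ht
  have hTt : T ≤ t := by linarith [abs_nonneg (F T)]
  have h := (convex_Ici T).image_sub_le_mul_sub_of_deriv_le (f := F) (C := -1)
    (fun s hs => (hder s hs).continuousAt.continuousWithinAt)
    (fun s hs => (hder s (interior_subset hs)).differentiableAt.differentiableWithinAt)
    (fun s hs => by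
      rw [(hder s (interior_subset hs)).deriv]
      exact (hT s (interior_subset hs)).1) T self_mem_Ici t hTt hTt
  linarith [le_abs_self (F T)]

lemma eventually_le_neg_one_of_iteratedDerivWithin {m : ℕ} {x : ℝ → ℝ}
    (hx : ContDiffOn ℝ m x (Ici 0))
    (h : ∀ᶠ t in atTop, iteratedDerivWithin m x (Ici 0) t ≤ -1) : ∀ᶠ t in atTop, x t ≤ -1 := by
  induction m with
  | zero => simpa using h
  | succ m ih =>
    exact ih (hx.of_le (by exact_mod_cast Nat.le_succ m))
      (eventually_le_neg_one_of_hasDerivWithinAt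
        (fun s hs => hasDerivWithinAt_iteratedDerivWithin hx hs) h)

/-- If `G + t ^ p` has no running maximum beyond some point, it is bounded above. -/
lemma exists_forall_le_of_no_running_max {H : ℝ → ℝ} {T : ℝ} (hT : 0 ≤ T)
    (hH : ContinuousOn H (Ici 0)) (hno : ∀ t > T, ∃ s ∈ Icc 0 t, H t < H s) :
    ∃ M, ∀ t ≥ 0, H t ≤ M := by
  obtain ⟨z, -, hz⟩ := isCompact_Icc.exists_isMaxOn (nonempty_Icc.2 hT)
    (hH.mono Icc_subset_Ici_self)
  refine ⟨H z, fun t ht => ?_⟩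
  by_contra! hlt
  obtain ⟨w, hw, hwmax⟩ := isCompact_Icc.exists_isMaxOn (nonempty_Icc.2 ht)
    (hH.mono Icc_subset_Ici_self)
  have hwt : H t ≤ H w := hwmax (right_mem_Icc.2 ht)
  have hwT : T < w := by
    by_contra! hle
    have : H w ≤ H z := hz ⟨hw.1, hle⟩
    linarith
  obtain ⟨s, hs, hlt'⟩ := hno w hwT
  have : H s ≤ H w := hwmax ⟨hs.1, hs.2.trans hw.2⟩
  linarith

/-- if `x` and `y_n` are eventually positive then
`limsup_{t→∞} x(t) < ∞`, i.e. `x` is eventually bounded above. -/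
theorem stmt15
    (n : ℕ) (hn3 : 3 ≤ n)
    (α β a : ℝ)
    (hβ : (n : ℝ) - 1 < β) (hβα : β < α) (hceil : ⌈α⌉₊ = n)
    (ha : 0 < a)
    (f : ℝ → ℝ) (q g : ℝ → ℝ)
    (hfc : Continuous f) (hqc : ContinuousOn q (Set.Ici 0))
    (hgc : ContinuousOn g (Set.Ici 0))
    (hG1 : ∀ u : ℝ, u ≠ 0 → 0 < u * f u)
    (hG2 : ∃ c₁ > (0:ℝ), ∃ η > (0:ℝ), ∀ u : ℝ, 1 ≤ |u| → c₁ * |u| ^ η ≤ |f u|)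
    (hH : ∃ T₁ > (0:ℝ), ∃ c₃ > (0:ℝ), ∀ t ≥ T₁, c₃ ≤ q t)
    (hK : ∃ σ : ℝ, (n : ℝ) - β < σ ∧ σ < 1 ∧
      ∃ c₄ > (0:ℝ), ∃ T₂ > (0:ℝ), ∀ t ≥ T₂, c₄ * t ^ ((n : ℝ) - β - σ) ≤ g t)
    (ξ : ℕ → ℝ) (x : ℝ → ℝ)
    (hx : ContCaputoDiffOnIci α x)
    (heq : ∀ t > (0:ℝ),
      caputoD α x t + a * caputoD β x t + q t * f (x t) + Real.sign (x t) * g t = 0)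
    (hinit : ∀ i < n, iteratedDeriv i x 0 = ξ i)
    (hxpos : ∃ T > (0:ℝ), ∀ t ≥ T, 0 < x t)
    (hynpos : ∃ T > (0:ℝ), ∀ t ≥ T, 0 < assocY n α β a ξ x n t) :
    ∃ M : ℝ, ∀ᶠ (t : ℝ) in Filter.atTop, x t ≤ M := by
  exfalso
  obtain ⟨m, rfl⟩ : ∃ m, n = m + 1 := ⟨n - 1, by omega⟩
  obtain ⟨σ, hσ1, hσ2, c₄, hc₄, T₂, -, hg⟩ := hK
  obtain ⟨T₁, -, c₃, hc₃, hq⟩ := hH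
  obtain ⟨T₀, -, hxp⟩ := hxpos
  have hβm : (m : ℝ) < β := by push_cast at hβ; linarith
  have hαn : α ≤ (m + 1 : ℕ) := hceil ▸ Nat.le_ceil α
  have hceilβ : ⌈β⌉₊ = m + 1 := by
    rw [Nat.ceil_eq_iff (by omega)]
    exact ⟨by simpa using hβm, by linarith⟩
  have hxC : ContDiffOn ℝ m x (Ici 0) := by
    have := hx.1
    rwa [hceil, Nat.add_sub_cancel] at this
  set p : ℝ := (1 - σ) / 2 with hp
  have hp0 : 0 < p := by linarith
  have hPC : ContDiff ℝ m (taylorPolyAt0 (m + 1) x) := by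
    unfold taylorPolyAt0
    fun_prop
  set y : ℝ → ℝ := fun s => x s - taylorPolyAt0 (m + 1) x s with hy
  have hyC : ContDiffOn ℝ m y (Ici 0) := hxC.sub hPC.contDiffOn
  set G := iteratedDerivWithin m y (Ici 0) with hG
  have hGc : ContinuousOn G (Ici 0) :=
    hyC.continuousOn_iteratedDerivWithin le_rfl (uniqueDiffOn_Ici 0)
  obtain ⟨Cα, hCα, hmaxα⟩ := exists_le_caputoD hp0 (hβm.trans hβα) hceil hyC
  obtain ⟨Cβ, hCβ, hmaxβ⟩ := exists_le_caputoD hp0 hβm hceilβ hyC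
  obtain ⟨T, hT⟩ := eventually_atTop.1
    (((tendsto_rpow_atTop hp0).eventually_gt_atTop ((Cα + a * Cβ) / c₄)).and
      ((eventually_ge_atTop 1).and ((eventually_ge_atTop T₀).and
        ((eventually_ge_atTop T₁).and (eventually_ge_atTop T₂)))))
  have hT1 : 1 ≤ T := (hT T le_rfl).2.1
  have hno : ∀ t > T, ∃ s ∈ Icc 0 t, G t + t ^ p < G s + s ^ p := by
    intro t ht
    by_contra! hmax
    obtain ⟨hbig, ht1, htT₀, htT₁, htT₂⟩ := hT t ht.le
    have ht0 : 0 < t := by linarith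
    have h1 := hmaxα t ht1 hmax
    have h2 := mul_le_mul_of_nonneg_left (hmaxβ t ht1 hmax) ha.le
    have h3 : t ^ (p + m - α) ≤ t ^ (p + m - β) :=
      Real.rpow_le_rpow_of_exponent_le ht1 (by linarith)
    have h4 := mul_le_mul_of_nonneg_left h3 hCα
    have hx0 := hxp t htT₀
    have hf0 : 0 < f (x t) := pos_of_mul_pos_right (hG1 (x t) hx0.ne') hx0.le
    have h5 : 0 < q t * f (x t) := mul_pos (hc₃.trans_le (hq t htT₁)) hf0
    have h6 := heq t ht0
    rw [Real.sign_of_pos hx0, one_mul] at h6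
    have h7 := hg t htT₂
    have h8 : t ^ (((m + 1 : ℕ) : ℝ) - β - σ) = t ^ p * t ^ (p + m - β) := by
      rw [← Real.rpow_add ht0]
      congr 1
      push_cast
      linarith
    rw [h8] at h7
    rw [div_lt_iff₀ hc₄] at hbig
    have h9 := mul_lt_mul_of_pos_right hbig (Real.rpow_pos_of_pos ht0 (p + m - β))
    linarith
  obtain ⟨M, hM⟩ := exists_forall_le_of_no_running_max (H := fun t => G t + t ^ p)
    (by linarith) (hGc.add (continuousOn_id.rpow_const fun _ _ => Or.inr hp0.le)) hno
  obtain ⟨K, hPK⟩ := exists_iteratedDeriv_sum_mul_pow_eq m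
    fun k => iteratedDeriv k x 0 / (Nat.factorial k : ℝ)
  have hneg : ∀ᶠ t in atTop, iteratedDerivWithin m x (Ici 0) t ≤ -1 := by
    filter_upwards [(tendsto_rpow_atTop hp0).eventually_ge_atTop (M + K + 1),
      eventually_ge_atTop 0] with t ht ht0
    have h1 : G t = iteratedDerivWithin m x (Ici 0) t -
        iteratedDerivWithin m (taylorPolyAt0 (m + 1) x) (Ici 0) t :=
      iteratedDerivWithin_sub ht0 (uniqueDiffOn_Ici 0) (hxC t ht0) hPC.contDiffAt.contDiffWithinAt
    rw [iteratedDerivWithin_eq_iteratedDeriv (uniqueDiffOn_Ici 0) hPC.contDiffAt ht0] at h1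
    have h2 : iteratedDeriv m (taylorPolyAt0 (m + 1) x) t = K := hPK t
    have h3 : G t + t ^ p ≤ M := hM t ht0
    linarith
  obtain ⟨t, ht, htT₀⟩ := ((eventually_le_neg_one_of_iteratedDerivWithin hxC hneg).and
    (eventually_ge_atTop T₀)).exists
  linarith [hxp t htT₀]
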